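/- Let V be a ⋆-unitary (1+n+1)×(1+n+1) Belavkin matrix over 𝔅 with middle indices partitioned into external e (size n_e) and internal i (size n_i), 0 < n_i < n, and let Φ(X) := 𝓕(V, X) for n_i×n_i complex matrices X with 1 - V_{ii}X invertible. Then for any X, Y in this domain with 1 - V_{ii}†Y† also invertible, the following Siegel-type identity holds: Φ(X) Φ(Y)⋆ = 𝕀 + R (1 - XV_{ii})^{-1} (XY† - 1) (1 - V_{ii}†Y†)^{-1} R⋆, where R is the block row (V_{i0}, V_{ie}, V_{i0′}) with n_i rows, and R⋆ := J_{n_e} R† J_{n_i} (the extended ⋆-involution for rectangular Belavkin matrices). -/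

import Mathlib

noncomputable section

open scoped BigOperators Matrix

/-- The Belavkin index set `{0} ⊕ middle ⊕ {0′}`. -/
abbrev BIdx (ι : Type*) : Type _ := Unit ⊕ ι ⊕ Unit

/-- The Belavkin `J` matrix: identity of the ring in positions `(0,0′)` and `(0′,0)`,
the identity in the middle block, and `0` elsewhere. -/
def Jmat (R : Type*) [Zero R] [One R] (ι : Type*) [DecidableEq ι] :
    Matrix (BIdx ι) (BIdx ι) R :=
  Matrix.of fun p q =>
    match p, q with
    | Sum.inl _, Sum.inr (Sum.inr _) => (1 : R)
    | Sum.inr (Sum.inr _), Sum.inl _ => 1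
    | Sum.inr (Sum.inl j), Sum.inr (Sum.inl k) => if j = k then 1 else 0
    | _, _ => 0

/-- The `⋆`-involution of a Belavkin matrix: `𝕏⋆ := J 𝕏† J`. -/
def bstar {R : Type*} [Semiring R] [StarRing R] {ι : Type*} [Fintype ι] [DecidableEq ι]
    (X : Matrix (BIdx ι) (BIdx ι) R) : Matrix (BIdx ι) (BIdx ι) R :=
  Jmat R ι * Xᴴ * Jmat R ι

/-- Embedding of the reduced (external) Belavkin index set into the full one,
relative to the partition `{1,…,n} = e ⊔ i`. -/
def embE {ne ni : ℕ} : BIdx (Fin ne) → BIdx (Fin ne ⊕ Fin ni)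
  | Sum.inl u => Sum.inl u
  | Sum.inr (Sum.inl e) => Sum.inr (Sum.inl (Sum.inl e))
  | Sum.inr (Sum.inr u) => Sum.inr (Sum.inr u)

/-- Embedding of an internal index into the full Belavkin index set. -/
def intI {ne ni : ℕ} (j : Fin ni) : BIdx (Fin ne ⊕ Fin ni) :=
  Sum.inr (Sum.inl (Sum.inr j))

/-- The internal-internal sub-block `V_ii`. -/
def blkII {R : Type*} {ne ni : ℕ}
    (V : Matrix (BIdx (Fin ne ⊕ Fin ni)) (BIdx (Fin ne ⊕ Fin ni)) R) :
    Matrix (Fin ni) (Fin ni) R :=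
  Matrix.of fun j k => V (intI j) (intI k)

/-- The block column `V_{αi}`, `α ∈ {0} ∪ e ∪ {0′}` (i.e. `(V_0i; V_ei; V_0′i)`). -/
def blkEI {R : Type*} {ne ni : ℕ}
    (V : Matrix (BIdx (Fin ne ⊕ Fin ni)) (BIdx (Fin ne ⊕ Fin ni)) R) :
    Matrix (BIdx (Fin ne)) (Fin ni) R :=
  Matrix.of fun a j => V (embE a) (intI j)

/-- The block row `V_{iβ}`, `β ∈ {0} ∪ e ∪ {0′}` (i.e. `(V_i0, V_ie, V_i0′)`). -/
def blkIE {R : Type*} {ne ni : ℕ}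
    (V : Matrix (BIdx (Fin ne ⊕ Fin ni)) (BIdx (Fin ne ⊕ Fin ni)) R) :
    Matrix (Fin ni) (BIdx (Fin ne)) R :=
  Matrix.of fun j b => V (intI j) (embE b)

/-- The external sub-matrix `V_{αβ}`, `α, β ∈ {0} ∪ e ∪ {0′}`. -/
def blkEE {R : Type*} {ne ni : ℕ}
    (V : Matrix (BIdx (Fin ne ⊕ Fin ni)) (BIdx (Fin ne ⊕ Fin ni)) R) :
    Matrix (BIdx (Fin ne)) (BIdx (Fin ne)) R :=
  Matrix.of fun a b => V (embE a) (embE b)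

variable {H₀ : Type*} [NormedAddCommGroup H₀] [InnerProductSpace ℂ H₀] [CompleteSpace H₀]

/-- The Gough–James feedback reduction
`𝓕(V, X)_{αβ} = V_{αβ} + V_{αi} X (1 - V_{ii}X)⁻¹ V_{iβ}` of a Belavkin matrix `V`
by a complex `n_i × n_i` matrix `X` (regarded in `𝔅` via `algebraMap`). -/
def FRed {ne ni : ℕ}
    (V : Matrix (BIdx (Fin ne ⊕ Fin ni)) (BIdx (Fin ne ⊕ Fin ni)) (H₀ →L[ℂ] H₀))
    (X : Matrix (Fin ni) (Fin ni) ℂ) :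
    Matrix (BIdx (Fin ne)) (BIdx (Fin ne)) (H₀ →L[ℂ] H₀) :=
  blkEE V + blkEI V * X.map (algebraMap ℂ (H₀ →L[ℂ] H₀)) *
    Ring.inverse (1 - blkII V * X.map (algebraMap ℂ (H₀ →L[ℂ] H₀))) * blkIE V

namespace Belavkin

section Blocks

variable {R : Type*} {ne ni : ℕ}

theorem sum_index [AddCommMonoid R] (f : BIdx (Fin ne ⊕ Fin ni) → R) :
    ∑ p, f p = ∑ a, f (embE a) + ∑ j, f (intI j) := by
  simp only [Fintype.sum_sum_type, embE, intI]
  abel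

theorem embE_injective : Function.Injective (embE (ne := ne) (ni := ni)) := by
  rintro (_ | _ | _) (_ | _ | _) h <;> simp_all [embE]

theorem intI_injective : Function.Injective (intI (ne := ne) (ni := ni)) := fun _ _ h => by
  simpa [intI] using h

theorem embE_ne_intI (a : BIdx (Fin ne)) (j : Fin ni) : embE a ≠ intI j := by
  rcases a with _ | _ | _ <;> simp [embE, intI]

variable [Semiring R] (M N : Matrix (BIdx (Fin ne ⊕ Fin ni)) (BIdx (Fin ne ⊕ Fin ni)) R)

theorem blkEE_mul : blkEE (M * N) = blkEE M * blkEE N + blkEI M * blkIE N := by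
  ext a b
  exact sum_index fun p => M (embE a) p * N p (embE b)

theorem blkEI_mul : blkEI (M * N) = blkEE M * blkEI N + blkEI M * blkII N := by
  ext a b
  exact sum_index fun p => M (embE a) p * N p (intI b)

theorem blkIE_mul : blkIE (M * N) = blkIE M * blkEE N + blkII M * blkIE N := by
  ext a b
  exact sum_index fun p => M (intI a) p * N p (embE b)

theorem blkII_mul : blkII (M * N) = blkIE M * blkEI N + blkII M * blkII N := by
  ext a b
  exact sum_index fun p => M (intI a) p * N p (intI b)

theorem blkEE_one :
    blkEE (1 : Matrix (BIdx (Fin ne ⊕ Fin ni)) (BIdx (Fin ne ⊕ Fin ni)) R) = 1 := by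
  ext a b
  simp [blkEE, Matrix.one_apply, embE_injective.eq_iff]

theorem blkEI_one :
    blkEI (1 : Matrix (BIdx (Fin ne ⊕ Fin ni)) (BIdx (Fin ne ⊕ Fin ni)) R) = 0 := by
  ext a b
  simp [blkEI, embE_ne_intI]

theorem blkIE_one :
    blkIE (1 : Matrix (BIdx (Fin ne ⊕ Fin ni)) (BIdx (Fin ne ⊕ Fin ni)) R) = 0 := by
  ext a b
  simp [blkIE, (embE_ne_intI _ _).symm]

theorem blkII_one :
    blkII (1 : Matrix (BIdx (Fin ne ⊕ Fin ni)) (BIdx (Fin ne ⊕ Fin ni)) R) = 1 := by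
  ext a b
  simp [blkII, Matrix.one_apply, intI_injective.eq_iff]

theorem blkEE_Jmat : blkEE (Jmat R (Fin ne ⊕ Fin ni)) = Jmat R (Fin ne) := by
  ext (_ | _ | _) (_ | _ | _) <;> simp [blkEE, Jmat, embE]

theorem blkEI_Jmat : blkEI (Jmat R (Fin ne ⊕ Fin ni)) = 0 := by
  ext (_ | _ | _) _ <;> simp [blkEI, Jmat, embE, intI]

theorem blkIE_Jmat : blkIE (Jmat R (Fin ne ⊕ Fin ni)) = 0 := by
  ext _ (_ | _ | _) <;> simp [blkIE, Jmat, embE, intI]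

theorem blkII_Jmat : blkII (Jmat R (Fin ne ⊕ Fin ni)) = 1 := by
  ext _ _
  simp [blkII, Jmat, intI, Matrix.one_apply]

variable [StarRing R]

theorem blkEE_conjTranspose : blkEE Mᴴ = (blkEE M)ᴴ := rfl

theorem blkEI_conjTranspose : blkEI Mᴴ = (blkIE M)ᴴ := rfl

theorem blkIE_conjTranspose : blkIE Mᴴ = (blkEI M)ᴴ := rfl

theorem blkII_conjTranspose : blkII Mᴴ = (blkII M)ᴴ := rfl

theorem blkEE_bstar : blkEE (bstar M) = bstar (blkEE M) := by
  simp [bstar, blkEE_mul, blkEI_mul, blkEE_Jmat, blkEI_Jmat, blkIE_Jmat, blkEE_conjTranspose]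

theorem blkEI_bstar : blkEI (bstar M) = Jmat R (Fin ne) * (blkIE M)ᴴ := by
  simp [bstar, blkEI_mul, blkEE_Jmat, blkEI_Jmat, blkII_Jmat, blkEI_conjTranspose]

theorem blkIE_bstar : blkIE (bstar M) = (blkEI M)ᴴ * Jmat R (Fin ne) := by
  simp [bstar, blkIE_mul, blkII_mul, blkEE_Jmat, blkIE_Jmat, blkII_Jmat, blkIE_conjTranspose]

theorem blkII_bstar : blkII (bstar M) = (blkII M)ᴴ := by
  simp [bstar, blkIE_mul, blkII_mul, blkEI_Jmat, blkIE_Jmat, blkII_Jmat, blkII_conjTranspose]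

end Blocks

section Inverse

variable {S : Type*} [Ring S]

theorem isUnit_one_sub_mul_swap {a b : S} (h : IsUnit (1 - a * b)) : IsUnit (1 - b * a) := by
  obtain ⟨u, hu⟩ := h
  have h₁ : (1 - a * b) * ↑u⁻¹ = 1 := by rw [← hu, Units.mul_inv]
  have h₂ : ↑u⁻¹ * (1 - a * b) = 1 := by rw [← hu, Units.inv_mul]
  refine ⟨⟨1 - b * a, 1 + b * ↑u⁻¹ * a, ?_, ?_⟩, rfl⟩
  · calc (1 - b * a) * (1 + b * ↑u⁻¹ * a)
        = 1 - b * a + b * ((1 - a * b) * ↑u⁻¹) * a := by noncomm_ring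
      _ = 1 := by rw [h₁]; noncomm_ring
  · calc (1 + b * ↑u⁻¹ * a) * (1 - b * a)
        = 1 - b * a + b * (↑u⁻¹ * (1 - a * b)) * a := by noncomm_ring
      _ = 1 := by rw [h₂]; noncomm_ring

theorem mul_inverse_one_sub_mul {a b : S} (h : IsUnit (1 - a * b)) :
    b * Ring.inverse (1 - a * b) = Ring.inverse (1 - b * a) * b := by
  have h' := isUnit_one_sub_mul_swap h
  calc b * Ring.inverse (1 - a * b)
      = Ring.inverse (1 - b * a) * (1 - b * a) * b * Ring.inverse (1 - a * b) := by
        rw [Ring.inverse_mul_cancel _ h', one_mul]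
    _ = Ring.inverse (1 - b * a) * b * ((1 - a * b) * Ring.inverse (1 - a * b)) := by
        noncomm_ring
    _ = Ring.inverse (1 - b * a) * b := by rw [Ring.mul_inverse_cancel _ h, mul_one]

theorem one_add_inverse_one_sub_mul {c : S} (h : IsUnit (1 - c)) :
    1 + Ring.inverse (1 - c) * c = Ring.inverse (1 - c) := by
  have := Ring.inverse_mul_cancel _ h
  rw [mul_sub, mul_one, sub_eq_iff_eq_add] at this
  exact this.symm

theorem one_add_mul_inverse_one_sub {c : S} (h : IsUnit (1 - c)) :
    1 + c * Ring.inverse (1 - c) = Ring.inverse (1 - c) := by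
  have := Ring.mul_inverse_cancel _ h
  rw [sub_mul, one_mul, sub_eq_iff_eq_add] at this
  exact this.symm

end Inverse

/-- The part of a Siegel-type identity that uses only the block relations of a unitary. -/
theorem mul_eq_one_sub_of_block_relations {R k m : Type*} [Ring R] [Fintype k] [DecidableEq k]
    [Fintype m] {A A' : Matrix k k R} {B C' P : Matrix k m R} {C B' Q : Matrix m k R}
    {D D' : Matrix m m R} [DecidableEq m]
    (hEE : A * A' + B * B' = 1) (hEI : A * C' + B * D' = 0)
    (hIE : C * A' + D * B' = 0) (hII : C * C' + D * D' = 1) :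
    (A + P * C) * (A' + C' * Q) = 1 + P * Q - (B + P * D) * (B' + D' * Q) := by
  have hEE' := eq_sub_of_add_eq hEE
  have hEI' := eq_neg_of_add_eq_zero_left hEI
  have hIE' := eq_neg_of_add_eq_zero_left hIE
  have hII' := eq_sub_of_add_eq hII
  calc (A + P * C) * (A' + C' * Q)
      = A * A' + A * C' * Q + P * (C * A') + P * (C * C') * Q := by
        simp only [Matrix.add_mul, Matrix.mul_add, Matrix.mul_assoc]
        abel
    _ = 1 + P * Q - (B + P * D) * (B' + D' * Q) := by
        rw [hEE', hEI', hIE', hII']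
        simp only [Matrix.add_mul, Matrix.mul_add, Matrix.mul_sub, Matrix.sub_mul,
          Matrix.mul_neg, Matrix.neg_mul, Matrix.mul_assoc, Matrix.mul_one]
        abel

theorem conjTranspose_map_algebraMap {m : Type*} (Y : Matrix m m ℂ) :
    (Y.map (algebraMap ℂ (H₀ →L[ℂ] H₀)))ᴴ = Yᴴ.map (algebraMap ℂ (H₀ →L[ℂ] H₀)) := by
  ext1 i j
  exact (algebraMap_star_comm (Y j i)).symm

end Belavkin

open Belavkin

/-- second Siegel-type identity.  For `Φ(X) := 𝓕(V, X)` with `V`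
`⋆`-unitary one has
`Φ(X) Φ(Y)⋆ = 𝕀 + B (1 - X V_ii)⁻¹ (X Y† - 1) (1 - V_ii† Y†)⁻¹ B⋆`,
where `B` collects the sub-blocks of `V` whose indices run over `{0} ∪ e ∪ {0′}` on one
side and over the internal set on the other (the blocks `V_i0, V_ie, V_i0′` of the
statement / their column counterparts `V_0i, V_ei, V_0′i`; matrix shapes dictate that the
left factor is the block column `(V_0i; V_ei; V_0′i)` of shape `(1+n_e+1) × n_i`), and
`B⋆ = J_{n_i} B† J_{n_e}` is the extended `⋆`-involution for rectangular Belavkin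
matrices, `J` on the bare internal index set being the `n_i × n_i` identity. -/
theorem FRed_siegel_second (ne ni : ℕ) (hne : 0 < ne) (hni : 0 < ni)
    (V : Matrix (BIdx (Fin ne ⊕ Fin ni)) (BIdx (Fin ne ⊕ Fin ni)) (H₀ →L[ℂ] H₀))
    (hV₁ : V * bstar V = 1) (hV₂ : bstar V * V = 1)
    (X Y : Matrix (Fin ni) (Fin ni) ℂ)
    (hX : IsUnit (1 - blkII V * X.map (algebraMap ℂ (H₀ →L[ℂ] H₀))))
    (hY : IsUnit (1 - blkII V * Y.map (algebraMap ℂ (H₀ →L[ℂ] H₀))))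
    (hY' : IsUnit (1 - (blkII V)ᴴ * (Yᴴ).map (algebraMap ℂ (H₀ →L[ℂ] H₀)))) :
    FRed V X * bstar (FRed V Y) =
      1 + blkEI V *
          Ring.inverse (1 - X.map (algebraMap ℂ (H₀ →L[ℂ] H₀)) * blkII V) *
          (X.map (algebraMap ℂ (H₀ →L[ℂ] H₀)) * (Yᴴ).map (algebraMap ℂ (H₀ →L[ℂ] H₀)) - 1) *
          Ring.inverse (1 - (blkII V)ᴴ * (Yᴴ).map (algebraMap ℂ (H₀ →L[ℂ] H₀))) *
          ((1 : Matrix (Fin ni) (Fin ni) (H₀ →L[ℂ] H₀)) * (blkEI V)ᴴ * Jmat (H₀ →L[ℂ] H₀) (Fin ne)) := by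
  have hEE := congrArg blkEE hV₁
  have hEI := congrArg blkEI hV₁
  have hIE := congrArg blkIE hV₁
  have hII := congrArg blkII hV₁
  rw [blkEE_mul, blkEE_one, blkEE_bstar, blkIE_bstar] at hEE
  rw [blkEI_mul, blkEI_one, blkEI_bstar, blkII_bstar] at hEI
  rw [blkIE_mul, blkIE_one, blkEE_bstar, blkIE_bstar] at hIE
  rw [blkII_mul, blkII_one, blkEI_bstar, blkII_bstar] at hII
  have hYstar := conjTranspose_map_algebraMap (H₀ := H₀) Y
  rw [← hYstar] at hY' ⊢
  unfold FRed
  generalize X.map (algebraMap ℂ (H₀ →L[ℂ] H₀)) = x at *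
  generalize Y.map (algebraMap ℂ (H₀ →L[ℂ] H₀)) = y at *
  generalize blkEE V = A at *
  generalize blkEI V = B at *
  generalize blkIE V = C at *
  generalize blkII V = D at *
  generalize hJ : Jmat (H₀ →L[ℂ] H₀) (Fin ne) = J at *
  have hbstar : bstar (A + B * y * Ring.inverse (1 - D * y) * C) =
      bstar A + J * Cᴴ * (yᴴ * Ring.inverse (1 - Dᴴ * yᴴ) * (Bᴴ * J)) := by
    have hinv : (Ring.inverse (1 - D * y))ᴴ = Ring.inverse (1 - yᴴ * Dᴴ) := by
      rw [← Matrix.star_eq_conjTranspose, ← Ring.inverse_star]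
      simp [Matrix.star_eq_conjTranspose]
    rw [mul_inverse_one_sub_mul hY']
    simp only [bstar, hJ, Matrix.conjTranspose_add, Matrix.conjTranspose_mul, hinv,
      Matrix.add_mul, Matrix.mul_add, Matrix.mul_assoc]
  have hxD := isUnit_one_sub_mul_swap hX
  have hleft : B + B * Ring.inverse (1 - x * D) * x * D = B * Ring.inverse (1 - x * D) := by
    conv_rhs => rw [← one_add_inverse_one_sub_mul hxD]
    simp only [Matrix.mul_add, Matrix.mul_one, Matrix.mul_assoc]
  have hright : Bᴴ * J + Dᴴ * (yᴴ * Ring.inverse (1 - Dᴴ * yᴴ) * (Bᴴ * J)) =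
      Ring.inverse (1 - Dᴴ * yᴴ) * (Bᴴ * J) := by
    conv_rhs => rw [← one_add_mul_inverse_one_sub hY']
    simp only [Matrix.add_mul, Matrix.one_mul, Matrix.mul_assoc]
  rw [hbstar, Matrix.mul_assoc B, mul_inverse_one_sub_mul hX, ← Matrix.mul_assoc B,
    mul_eq_one_sub_of_block_relations hEE hEI hIE hII, hleft, hright]
  simp only [Matrix.mul_sub, Matrix.sub_mul, Matrix.mul_one, Matrix.one_mul, Matrix.mul_assoc]
  abel
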